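/- Fix L < ∞ and let Ω := {(α, A) ∈ 𝕋^d × C⁰(𝕋^d, SL_m(ℝ)) : sup_θ ‖A(θ)‖ ≤ L}. On the set of compactly supported Borel probability measures ν on Ω for which the base map f(ω, θ) = (σω, θ + α₀) is ergodic with respect to ν^ℤ × m, the maximal Lyapunov exponent ν ↦ L₁(ν) is upper semicontinuous with respect to the Wasserstein distance W₁: for every such ergodic ν₀ and every ε > 0 there is δ > 0 such that every ergodic ν with W₁(ν, ν₀) < δ satisfies L₁(ν) < L₁(ν₀) + ε. -/

import Mathlib

open MeasureTheory Filter Topology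

noncomputable section

/-- The `d`-dimensional torus `𝕋^d = (ℝ/ℤ)^d`; `volume` on it is the Haar
probability measure `m`. -/
abbrev Td (d : ℕ) : Type := Fin d → AddCircle (1 : ℝ)

instance : IsProbabilityMeasure (volume : Measure (AddCircle (1:ℝ))) :=
  ⟨by rw [AddCircle.measure_univ]; norm_num⟩

/-- The group `SL_m(ℝ)`. -/
abbrev SL (m : ℕ) := Matrix.SpecialLinearGroup (Fin m) ℝ

instance (m : ℕ) : TopologicalSpace (SL m) :=
  inferInstanceAs (TopologicalSpace {A : Matrix (Fin m) (Fin m) ℝ // A.det = 1})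

/-- The space `𝒢 = 𝕋^d × C⁰(𝕋^d, SL_m(ℝ))` of quasiperiodic cocycles. -/
abbrev QPC (d m : ℕ) := Td d × C(Td d, SL m)

/-- The (ℓ² → ℓ²) operator norm of a real matrix. -/
def matOpNorm {m : ℕ} (A : Matrix (Fin m) (Fin m) ℝ) : ℝ :=
  ‖LinearMap.toContinuousLinearMap (Matrix.toEuclideanLin A)‖

/-- The set `Ω = 𝒢_L` of quasiperiodic cocycles with fiber norm bounded by `L`. -/
def OmegaL (d m : ℕ) (L : ℝ) : Type :=
  {x : QPC d m // ∀ θ : Td d, matOpNorm ((x.2 θ : Matrix (Fin m) (Fin m) ℝ)) ≤ L}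

instance (d m : ℕ) (L : ℝ) : TopologicalSpace (OmegaL d m L) :=
  inferInstanceAs (TopologicalSpace {x : QPC d m // ∀ θ : Td d,
    matOpNorm ((x.2 θ : Matrix (Fin m) (Fin m) ℝ)) ≤ L})

instance (d m : ℕ) (L : ℝ) : MeasurableSpace (OmegaL d m L) := borel _

/-- The distance on `𝒢`: the sum of the torus distance and the uniform
(operator-norm) distance on `C⁰(𝕋^d, SL_m(ℝ))`. -/
def qpcDist {d m : ℕ} (x y : QPC d m) : ℝ :=
  dist x.1 y.1 + ⨆ θ : Td d,
    matOpNorm (((x.2 θ : Matrix (Fin m) (Fin m) ℝ)) -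
      ((y.2 θ : Matrix (Fin m) (Fin m) ℝ)))

/-- The Wasserstein distance w.r.t. an explicit distance function `ρ`:
`sup {∫ g d(ν − ν') : g is 1-Lipschitz for ρ}`. -/
def W1rho {M : Type*} [MeasurableSpace M] (ρ : M → M → ℝ)
    (ν ν' : Measure M) : ℝ :=
  sSup {r | ∃ g : M → ℝ, (∀ x y, |g x - g y| ≤ ρ x y) ∧
    r = (∫ x, g x ∂ν) - ∫ x, g x ∂ν'}

/-- `P` is the Bernoulli product measure `ν^ι` on `ι → Ω`. -/
def IsBernoulli {Ω ι : Type*} [MeasurableSpace Ω] (ν : Measure Ω)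
    (P : Measure (ι → Ω)) : Prop :=
  IsProbabilityMeasure P ∧
    ∀ (s : Finset ι) (E : ι → Set Ω), (∀ i, MeasurableSet (E i)) →
      P {ω | ∀ i ∈ s, ω i ∈ E i} = ∏ i ∈ s, ν (E i)

/-- The sum `α₀ + ⋯ + α_{n−1}` of the first `n` frequencies. -/
def freqSum {d m : ℕ} {L : ℝ} (ω : ℤ → OmegaL d m L) (n : ℕ) : Td d :=
  ∑ i ∈ Finset.range n, ((ω (i : ℤ)).val.1)

/-- The cocycle iterates `𝒜ⁿ(ω)(θ) = A_{n−1}(θ + α₀ + ⋯ + α_{n−2}) ⋯ A₀(θ)`. -/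
def cocycleIter {d m : ℕ} {L : ℝ} (ω : ℤ → OmegaL d m L) :
    ℕ → Td d → Matrix (Fin m) (Fin m) ℝ
  | 0 => fun _ => 1
  | n + 1 => fun θ =>
      (((ω (n : ℤ)).val.2 (θ + freqSum ω n) : Matrix (Fin m) (Fin m) ℝ)) *
        cocycleIter ω n θ

/-- The mixed random-quasiperiodic base map `f(ω, θ) = (σω, θ + α₀)`. -/
def baseMap {d m : ℕ} {L : ℝ} :
    ((ℤ → OmegaL d m L) × Td d) → ((ℤ → OmegaL d m L) × Td d) :=
  fun p => (fun n => p.1 (n + 1), p.2 + (p.1 0).val.1)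


section Wasserstein

variable {M : Type*} [PseudoMetricSpace M] [MeasurableSpace M]

/-- If `ν` and `ν'` almost agree on 1-Lipschitz functions, they almost agree on `K`-Lipschitz
functions. -/
lemma integral_sub_le_of_lipschitz {ν ν' : Measure M} {δ : ℝ}
    (h : ∀ g : M → ℝ, (∀ x y, |g x - g y| ≤ dist x y) → ∫ x, g x ∂ν - ∫ x, g x ∂ν' ≤ δ)
    {K : ℝ} (hK : 0 < K) {g : M → ℝ} (hg : ∀ x y, |g x - g y| ≤ K * dist x y) :
    ∫ x, g x ∂ν - ∫ x, g x ∂ν' ≤ K * δ := by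
  have := h (fun x => K⁻¹ * g x) fun x y => by
    rw [← mul_sub, abs_mul, abs_of_pos (inv_pos.2 hK), inv_mul_le_iff₀ hK]
    exact hg x y
  rw [integral_const_mul, integral_const_mul, ← mul_sub, inv_mul_le_iff₀ hK] at this
  exact this

lemma continuous_of_abs_sub_le {X : Type*} [PseudoMetricSpace X] {K : ℝ} (hK : 0 < K)
    {g : X → ℝ} (hg : ∀ x y, |g x - g y| ≤ K * dist x y) : Continuous g :=
  (LipschitzWith.of_dist_le_mul (K := ⟨K, hK.le⟩) fun x y => by
    rw [Real.dist_eq]; exact hg x y).continuous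

lemma integrable_of_continuous_of_bound {X : Type*} [TopologicalSpace X] [MeasurableSpace X]
    [OpensMeasurableSpace X] {μ : Measure X} [IsFiniteMeasure μ]
    {g : X → ℝ} (hg : Continuous g) {C : ℝ} (hC : ∀ x, |g x| ≤ C) : Integrable g μ :=
  Integrable.of_bound hg.measurable.aestronglyMeasurable C (.of_forall hC)

variable [SecondCountableTopology M] [BorelSpace M]

/-- Closeness on 1-Lipschitz functions passes to finite powers. -/
lemma integral_pi_sub_le_of_lipschitz {ν ν' : Measure M} [IsProbabilityMeasure ν]
    [IsProbabilityMeasure ν'] {δ : ℝ}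
    (h : ∀ g : M → ℝ, (∀ x y, |g x - g y| ≤ dist x y) → ∫ x, g x ∂ν - ∫ x, g x ∂ν' ≤ δ)
    {K C : ℝ} (hK : 0 < K) (n : ℕ) :
    ∀ g : (Fin n → M) → ℝ, (∀ x y, |g x - g y| ≤ K * dist x y) → (∀ x, |g x| ≤ C) →
      ∫ x, g x ∂(Measure.pi fun _ => ν) - ∫ x, g x ∂(Measure.pi fun _ => ν') ≤ n * (K * δ) := by
  induction n with
  | zero =>
    intro g _ _
    rw [Measure.pi_of_empty (fun _ => ν), Measure.pi_of_empty (fun _ => ν')]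
    simp
  | succ n ih =>
    intro g hg hC
    have key : ∀ μ : Measure M, IsProbabilityMeasure μ →
        ∫ x, g x ∂(Measure.pi fun _ => μ) =
          ∫ a, ∫ y, g (Fin.cons a y) ∂(Measure.pi fun _ : Fin n => μ) ∂μ := by
      intro μ _
      have e := (measurePreserving_piFinSuccAbove (fun _ : Fin (n + 1) => μ) 0).symm
      rw [← e.integral_comp' g, integral_prod]
      · simp [MeasurableEquiv.piFinSuccAbove_symm_apply, Fin.insertNthEquiv_zero]
        rfl
      · refine Integrable.of_bound (C := C) ?_ (.of_forall fun _ => hC _)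
        exact ((continuous_of_abs_sub_le hK hg).measurable.comp
          e.measurable).aestronglyMeasurable
    have h_int : ∀ (μ : Measure M) [IsProbabilityMeasure μ] (a : M),
        Integrable (fun y => g (Fin.cons a y)) (Measure.pi fun _ : Fin n => μ) := fun μ _ a =>
      integrable_of_continuous_of_bound
        ((continuous_of_abs_sub_le hK hg).comp (by fun_prop)) fun _ => hC _
    have hcons : ∀ a b : M, ∀ y : Fin n → M,
        dist (Fin.cons a y : Fin (n + 1) → M) (Fin.cons b y) ≤ dist a b := by
      intro a b y
      rw [dist_pi_le_iff dist_nonneg]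
      intro i
      refine Fin.cases ?_ (fun j => ?_) i <;> simp
    have hcons' : ∀ a : M, ∀ y z : Fin n → M,
        dist (Fin.cons a y : Fin (n + 1) → M) (Fin.cons a z) ≤ dist y z := by
      intro a y z
      rw [dist_pi_le_iff dist_nonneg]
      intro i
      refine Fin.cases ?_ (fun j => ?_) i
      · simp
      · simpa using dist_le_pi_dist y z j
    have hlip : ∀ (μ : Measure M) [IsProbabilityMeasure μ] (a b : M),
        |∫ y, g (Fin.cons a y) ∂(Measure.pi fun _ : Fin n => μ) -
          ∫ y, g (Fin.cons b y) ∂(Measure.pi fun _ : Fin n => μ)| ≤ K * dist a b := by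
      intro μ _ a b
      rw [← integral_sub (h_int μ a) (h_int μ b)]
      have := norm_integral_le_of_norm_le_const (μ := Measure.pi fun _ : Fin n => μ)
        (f := fun y => g (Fin.cons a y) - g (Fin.cons b y)) (C := K * dist a b)
        (.of_forall fun y => (hg _ _).trans (mul_le_mul_of_nonneg_left (hcons a b y) hK.le))
      rwa [probReal_univ, mul_one] at this
    have hbd : ∀ (μ : Measure M) [IsProbabilityMeasure μ] (a : M),
        |∫ y, g (Fin.cons a y) ∂(Measure.pi fun _ : Fin n => μ)| ≤ C := by
      intro μ _ a
      have := norm_integral_le_of_norm_le_const (μ := Measure.pi fun _ : Fin n => μ)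
        (f := fun y => g (Fin.cons a y)) (C := C) (.of_forall fun y => hC _)
      rwa [probReal_univ, mul_one] at this
    have h_int' : ∀ (μ ρ : Measure M) [IsProbabilityMeasure μ] [IsProbabilityMeasure ρ],
        Integrable (fun a => ∫ y, g (Fin.cons a y) ∂(Measure.pi fun _ : Fin n => μ)) ρ :=
      fun μ ρ _ _ => integrable_of_continuous_of_bound
        (continuous_of_abs_sub_le hK (hlip μ)) (hbd μ)
    rw [key ν inferInstance, key ν' inferInstance]
    have h1 : ∫ a, ∫ y, g (Fin.cons a y) ∂(Measure.pi fun _ : Fin n => ν) ∂ν ≤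
        ∫ a, ((∫ y, g (Fin.cons a y) ∂(Measure.pi fun _ : Fin n => ν')) + n * (K * δ)) ∂ν := by
      refine integral_mono (h_int' ν ν) ((h_int' ν' ν).add (integrable_const _)) fun a => ?_
      have := ih (fun y => g (Fin.cons a y))
        (fun y z => (hg _ _).trans (mul_le_mul_of_nonneg_left (hcons' a y z) hK.le))
        (fun _ => hC _)
      simp only
      linarith
    rw [integral_add (h_int' ν' ν) (integrable_const _)] at h1
    have h2 := integral_sub_le_of_lipschitz h hK (hlip ν')
    simp only [integral_const, probReal_univ, one_smul] at h1
    push_cast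
    linarith

/-- The sup-convolution of `Φ` with slope `k`. -/
def supConv {X : Type*} [PseudoMetricSpace X] (Φ : X → ℝ) (k : ℝ) (x : X) : ℝ :=
  ⨆ y, (Φ y - k * dist x y)

section supConv

variable {X : Type*} [PseudoMetricSpace X] {Φ : X → ℝ} {C k : ℝ}

lemma supConv_bddAbove (hC : ∀ x, |Φ x| ≤ C) (hk : 0 ≤ k) (x : X) :
    BddAbove (Set.range fun y => Φ y - k * dist x y) := by
  refine ⟨C, ?_⟩
  rintro _ ⟨y, rfl⟩
  have := (abs_le.1 (hC y)).2
  have : 0 ≤ k * dist x y := by positivity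
  simp only
  linarith

lemma le_supConv (hC : ∀ x, |Φ x| ≤ C) (hk : 0 ≤ k) (x : X) : Φ x ≤ supConv Φ k x := by
  simpa [supConv] using le_ciSup (supConv_bddAbove hC hk x) x

lemma supConv_lipschitz (hC : ∀ x, |Φ x| ≤ C) (hk : 0 ≤ k) (x y : X) :
    |supConv Φ k x - supConv Φ k y| ≤ k * dist x y := by
  have aux : ∀ x y : X, supConv Φ k x ≤ supConv Φ k y + k * dist x y := by
    intro x y
    have : Nonempty X := ⟨x⟩
    refine ciSup_le fun z => ?_
    have h1 := le_ciSup (supConv_bddAbove hC hk y) z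
    have h2 := mul_le_mul_of_nonneg_left (dist_triangle y x z) hk
    rw [dist_comm y x] at h2
    simp only [supConv] at *
    linarith
  rw [abs_le]
  have h1 := aux x y
  have h2 := aux y x
  rw [dist_comm y x] at h2
  constructor <;> linarith

lemma abs_supConv_le (hC : ∀ x, |Φ x| ≤ C) (hk : 0 ≤ k) (x : X) : |supConv Φ k x| ≤ C := by
  have : Nonempty X := ⟨x⟩
  rw [abs_le]
  refine ⟨(abs_le.1 (hC x)).1.trans (le_supConv hC hk x), ciSup_le fun y => ?_⟩
  have := (abs_le.1 (hC y)).2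
  have : 0 ≤ k * dist x y := by positivity
  linarith

lemma tendsto_supConv (hΦ : Continuous Φ) (hC : ∀ x, |Φ x| ≤ C) (x : X) :
    Tendsto (fun k : ℕ => supConv Φ (k + 1) x) atTop (𝓝 (Φ x)) := by
  have : Nonempty X := ⟨x⟩
  have hC0 : 0 ≤ C := (abs_nonneg _).trans (hC x)
  rw [Metric.tendsto_atTop]
  intro η hη
  obtain ⟨r, hr, hr'⟩ := Metric.continuous_iff.1 hΦ x (η / 2) (half_pos hη)
  obtain ⟨N, hN⟩ := exists_nat_gt (2 * C / r)
  refine ⟨N, fun k hk => ?_⟩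
  have hle := le_supConv hC (by positivity : (0 : ℝ) ≤ k + 1) x
  have hup : supConv Φ (k + 1) x ≤ Φ x + η / 2 := by
    refine ciSup_le fun y => ?_
    have h0 : 0 ≤ ((k : ℝ) + 1) * dist x y := by positivity
    rcases lt_or_ge (dist y x) r with hy | hy
    · have := (abs_lt.1 (hr' y hy)).2
      linarith
    · have h1 : 2 * C < N * r := (div_lt_iff₀ hr).1 hN
      have hkN : (N : ℝ) ≤ k + 1 := by
        have : (N : ℝ) ≤ k := by exact_mod_cast hk
        linarith
      have h2 : (N : ℝ) * r ≤ ((k : ℝ) + 1) * dist x y := by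
        rw [dist_comm x y]; gcongr
      have := (abs_le.1 (hC y)).2
      have := (abs_le.1 (hC x)).1
      linarith
  rw [Real.dist_eq, abs_lt]
  constructor <;> linarith

end supConv

/-- Upper semicontinuity, with respect to the Wasserstein distance, of the integral of a bounded
continuous function against finite powers of a measure. -/
lemma exists_integral_pi_lt (ν' : Measure M) [IsProbabilityMeasure ν'] {n : ℕ}
    {Φ : (Fin n → M) → ℝ} (hΦ : Continuous Φ) {C : ℝ} (hC : ∀ x, |Φ x| ≤ C) {η : ℝ}
    (hη : 0 < η) :
    ∃ δ > (0 : ℝ), ∀ ν : Measure M, IsProbabilityMeasure ν →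
      (∀ g : M → ℝ, (∀ x y, |g x - g y| ≤ dist x y) → ∫ x, g x ∂ν - ∫ x, g x ∂ν' ≤ δ) →
      ∫ x, Φ x ∂(Measure.pi fun _ => ν) < ∫ x, Φ x ∂(Measure.pi fun _ => ν') + η := by
  have hcont : ∀ k : ℕ, Continuous (supConv Φ (k + 1)) := fun k =>
    continuous_of_abs_sub_le (by positivity) (supConv_lipschitz hC (by positivity))
  have hlim : Tendsto (fun k : ℕ => ∫ x, supConv Φ (k + 1) x ∂(Measure.pi fun _ => ν')) atTop
      (𝓝 (∫ x, Φ x ∂(Measure.pi fun _ => ν'))) := by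
    refine tendsto_integral_of_dominated_convergence (fun _ => C)
      (fun k => (hcont k).measurable.aestronglyMeasurable) (integrable_const _)
      (fun k => .of_forall fun x => abs_supConv_le hC (by positivity) x)
      (.of_forall fun x => tendsto_supConv hΦ hC x)
  obtain ⟨k, hk⟩ := (hlim.eventually_lt_const
    (show _ < (∫ x, Φ x ∂(Measure.pi fun _ => ν')) + η / 2 by linarith)).exists
  have hK : (0 : ℝ) < k + 1 := by positivity
  refine ⟨η / (2 * ((n + 1) * (k + 1))), by positivity, fun ν _ h => ?_⟩
  have h1 := integral_pi_sub_le_of_lipschitz h hK n (supConv Φ (k + 1))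
    (supConv_lipschitz hC hK.le) (abs_supConv_le hC hK.le)
  have h2 : ∫ x, Φ x ∂(Measure.pi fun _ => ν) ≤
      ∫ x, supConv Φ (k + 1) x ∂(Measure.pi fun _ => ν) :=
    integral_mono (integrable_of_continuous_of_bound hΦ hC)
      (integrable_of_continuous_of_bound (hcont k) (abs_supConv_le hC hK.le))
      (le_supConv hC hK.le)
  have h3 : (n : ℝ) * (((k : ℝ) + 1) * (η / (2 * ((n + 1) * (k + 1))))) ≤ η / 2 := by
    have : (n : ℝ) * (((k : ℝ) + 1) * (η / (2 * ((n + 1) * (k + 1))))) =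
        (n / (n + 1)) * (η / 2) := by field_simp
    rw [this]
    have h4 : (n : ℝ) / (n + 1) ≤ 1 := by rw [div_le_one (by positivity)]; linarith
    nlinarith
  linarith

end Wasserstein

section Cocycles

variable {d m : ℕ} {L : ℝ}

/-- The linear identification of matrices with operators on Euclidean space. -/
def matCLM (m : ℕ) : Matrix (Fin m) (Fin m) ℝ ≃ₗ[ℝ]
    (EuclideanSpace ℝ (Fin m) →L[ℝ] EuclideanSpace ℝ (Fin m)) :=
  Matrix.toEuclideanLin.trans LinearMap.toContinuousLinearMap

lemma matOpNorm_eq (A : Matrix (Fin m) (Fin m) ℝ) : matOpNorm A = ‖matCLM m A‖ := rfl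

lemma matCLM_mul (A B : Matrix (Fin m) (Fin m) ℝ) : matCLM m (A * B) = matCLM m A * matCLM m B :=
  map_mul (Matrix.toEuclideanCLM (n := Fin m) (𝕜 := ℝ)) A B

lemma matCLM_one : matCLM m 1 = 1 :=
  map_one (Matrix.toEuclideanCLM (n := Fin m) (𝕜 := ℝ))

lemma matCLM_pow (A : Matrix (Fin m) (Fin m) ℝ) (k : ℕ) : matCLM m (A ^ k) = matCLM m A ^ k :=
  map_pow (Matrix.toEuclideanCLM (n := Fin m) (𝕜 := ℝ)) A k

lemma continuous_matCLM : Continuous (matCLM m) :=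
  LinearMap.continuous_of_finiteDimensional (matCLM m).toLinearMap

lemma continuous_matCLM_symm : Continuous (matCLM m).symm :=
  LinearMap.continuous_of_finiteDimensional (matCLM m).symm.toLinearMap

lemma isInducing_matCLM : IsInducing (matCLM m) :=
  .of_comp continuous_matCLM continuous_matCLM_symm (by
    have : ((matCLM m).symm ∘ matCLM m) = id := by ext1; simp
    rw [this]; exact .id)

lemma continuous_matOpNorm : Continuous (matOpNorm (m := m)) :=
  continuous_norm.comp continuous_matCLM

lemma matOpNorm_mul_le (A B : Matrix (Fin m) (Fin m) ℝ) :
    matOpNorm (A * B) ≤ matOpNorm A * matOpNorm B := by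
  simp only [matOpNorm_eq, matCLM_mul]
  exact norm_mul_le _ _

lemma one_le_matOpNorm_of_det_eq_one [NeZero m] {A : Matrix (Fin m) (Fin m) ℝ}
    (hA : A.det = 1) : 1 ≤ matOpNorm A := by
  by_contra! h
  have h1 := tendsto_pow_atTop_nhds_zero_of_norm_lt_one (x := matCLM m A) h
  have h2 : Tendsto (fun k : ℕ => ((matCLM m).symm (matCLM m A ^ k)).det) atTop
      (𝓝 ((matCLM m).symm 0).det) :=
    ((Continuous.matrix_det continuous_id).comp continuous_matCLM_symm).continuousAt.tendsto.comp h1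
  have : Nonempty (Fin m) := Fin.pos_iff_nonempty.1 (NeZero.pos m)
  simp only [← matCLM_pow, LinearEquiv.symm_apply_apply, Matrix.det_pow, hA, one_pow,
    map_zero, Matrix.det_zero] at h2
  exact one_ne_zero (tendsto_nhds_unique tendsto_const_nhds h2)

lemma continuous_SL_coe : Continuous fun A : SL m => (A : Matrix (Fin m) (Fin m) ℝ) :=
  continuous_subtype_val

lemma isInducing_SL : IsInducing fun A : SL m => matCLM m (A : Matrix (Fin m) (Fin m) ℝ) :=
  isInducing_matCLM.comp IsInducing.subtypeVal

/-- The inclusion of `SL_m(ℝ)` into operators, as a continuous map. -/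
def slCLM (m : ℕ) : C(SL m, EuclideanSpace ℝ (Fin m) →L[ℝ] EuclideanSpace ℝ (Fin m)) :=
  ⟨_, isInducing_SL.continuous⟩

/-- The embedding of `Ω` into a metric space. -/
def omegaEmb (x : OmegaL d m L) :
    Td d × C(Td d, EuclideanSpace ℝ (Fin m) →L[ℝ] EuclideanSpace ℝ (Fin m)) :=
  (x.val.1, (slCLM m).comp x.val.2)

lemma isInducing_omegaEmb : IsInducing (omegaEmb (d := d) (m := m) (L := L)) :=
  (IsInducing.id.prodMap (ContinuousMap.isInducing_postcomp (slCLM m) isInducing_SL)).comp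
    IsInducing.subtypeVal

instance : PseudoMetricSpace (OmegaL d m L) := 
  IsInducing.comapPseudoMetricSpace (f := omegaEmb) isInducing_omegaEmb

instance : BorelSpace (OmegaL d m L) := ⟨rfl⟩

instance : SecondCountableTopology (OmegaL d m L) :=
  have : ProperSpace (EuclideanSpace ℝ (Fin m) →L[ℝ] EuclideanSpace ℝ (Fin m)) :=
    FiniteDimensional.proper ℝ _
  isInducing_omegaEmb.secondCountableTopology

lemma qpcDist_eq (x y : OmegaL d m L) : qpcDist x.val y.val =
    dist (omegaEmb x).1 (omegaEmb y).1 + dist (omegaEmb x).2 (omegaEmb y).2 := by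
  rw [dist_eq_norm (omegaEmb x).2, ContinuousMap.norm_eq_iSup_norm, qpcDist]
  congr 2
  ext θ
  rw [matOpNorm_eq, map_sub]
  rfl

lemma dist_eq_dist_omegaEmb (x y : OmegaL d m L) : dist x y = dist (omegaEmb x) (omegaEmb y) := rfl

lemma dist_le_qpcDist (x y : OmegaL d m L) : dist x y ≤ qpcDist x.val y.val := by
  rw [qpcDist_eq, dist_eq_dist_omegaEmb, Prod.dist_eq]
  exact max_le_add_of_nonneg dist_nonneg dist_nonneg

lemma qpcDist_le (x y : OmegaL d m L) : qpcDist x.val y.val ≤ 2 * dist x y := by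
  rw [qpcDist_eq, dist_eq_dist_omegaEmb, Prod.dist_eq, two_mul]
  exact add_le_add (le_max_left _ _) (le_max_right _ _)

lemma exists_qpcDist_bound : ∃ C, ∀ x y : OmegaL d m L, qpcDist x.val y.val ≤ C := by
  refine ⟨Metric.diam (Set.univ : Set (Td d)) + (L + L), fun x y => ?_⟩
  refine add_le_add (Metric.dist_le_diam_of_mem isCompact_univ.isBounded trivial trivial)
    (ciSup_le fun θ => ?_)
  rw [matOpNorm_eq, map_sub]
  exact (norm_sub_le _ _).trans (add_le_add (x.2 θ) (y.2 θ))

lemma integral_sub_le_W1rho (ν ν' : Measure (OmegaL d m L)) [IsProbabilityMeasure ν]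
    [IsProbabilityMeasure ν'] {g : OmegaL d m L → ℝ} (hg : ∀ x y, |g x - g y| ≤ dist x y) :
    ∫ x, g x ∂ν - ∫ x, g x ∂ν' ≤ W1rho (fun x y => qpcDist x.val y.val) ν ν' := by
  refine le_csSup ?_ ⟨g, fun x y => (hg x y).trans (dist_le_qpcDist x y), rfl⟩
  obtain ⟨C, hC⟩ := exists_qpcDist_bound (d := d) (m := m) (L := L)
  obtain ⟨x₀⟩ := nonempty_of_isProbabilityMeasure ν
  refine ⟨C + C, ?_⟩
  rintro _ ⟨g, hg, rfl⟩
  have hcont : Continuous g := continuous_of_abs_sub_le two_pos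
    fun x y => (hg x y).trans (qpcDist_le x y)
  have hbd : ∀ x, |g x - g x₀| ≤ C := fun x => (hg x x₀).trans (hC x x₀)
  have aux : ∀ μ : Measure (OmegaL d m L), IsProbabilityMeasure μ →
      |∫ x, g x ∂μ - g x₀| ≤ C := by
    intro μ _
    have h_int : Integrable g μ := integrable_of_continuous_of_bound hcont (C := C + |g x₀|)
      fun x => by
        have := abs_add_le (g x - g x₀) (g x₀)
        rw [sub_add_cancel] at this
        linarith [hbd x]
    have := norm_integral_le_of_norm_le_const (μ := μ) (f := fun x => g x - g x₀)
      (.of_forall hbd)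
    rwa [probReal_univ, mul_one, integral_sub h_int (integrable_const _), integral_const,
      probReal_univ, one_smul, Real.norm_eq_abs] at this
  have h1 := (abs_le.1 (aux ν inferInstance)).2
  have h2 := (abs_le.1 (aux ν' inferInstance)).1
  linarith

lemma continuous_fst_coord (i : ℤ) :
    Continuous fun ω : ℤ → OmegaL d m L => (ω i).val.1 :=
  continuous_fst.comp (continuous_subtype_val.comp (continuous_apply i))

lemma continuous_snd_coord (i : ℤ) :
    Continuous fun ω : ℤ → OmegaL d m L => (ω i).val.2 :=
  continuous_snd.comp (continuous_subtype_val.comp (continuous_apply i))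

lemma continuous_freqSum (n : ℕ) : Continuous fun ω : ℤ → OmegaL d m L => freqSum ω n :=
  continuous_finsetSum _ fun i _ => continuous_fst_coord (i : ℤ)

lemma continuous_cocycleIter (n : ℕ) :
    Continuous fun p : (ℤ → OmegaL d m L) × Td d => cocycleIter p.1 n p.2 := by
  induction n with
  | zero => exact continuous_const
  | succ n ih =>
    refine Continuous.matrix_mul (continuous_SL_coe.comp ?_) ih
    exact ((continuous_snd_coord (n : ℤ)).comp continuous_fst).eval
      (continuous_snd.add ((continuous_freqSum n).comp continuous_fst))

lemma cocycleIter_succ (ω : ℤ → OmegaL d m L) (n : ℕ) (θ : Td d) :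
    cocycleIter ω (n + 1) θ = ((ω (n : ℤ)).val.2 (θ + freqSum ω n) : Matrix (Fin m) (Fin m) ℝ) *
      cocycleIter ω n θ := rfl

lemma det_cocycleIter (ω : ℤ → OmegaL d m L) (n : ℕ) (θ : Td d) :
    (cocycleIter ω n θ).det = 1 := by
  induction n with
  | zero => simp [cocycleIter]
  | succ n ih => simp [cocycleIter_succ, Matrix.det_mul, ih]

lemma cocycleIter_congr {ω ω' : ℤ → OmegaL d m L} {n : ℕ}
    (h : ∀ i < n, ω (i : ℤ) = ω' (i : ℤ)) (θ : Td d) :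
    cocycleIter ω n θ = cocycleIter ω' n θ := by
  induction n with
  | zero => rfl
  | succ n ih =>
    have hf : freqSum ω n = freqSum ω' n :=
      Finset.sum_congr rfl fun i hi => by rw [h i (by have := Finset.mem_range.1 hi; omega)]
    rw [cocycleIter_succ, cocycleIter_succ, ih fun i hi => h i (by omega), hf, h n (by omega)]

lemma baseMap_iterate (n : ℕ) (p : (ℤ → OmegaL d m L) × Td d) :
    baseMap^[n] p = (fun i => p.1 (i + n), p.2 + freqSum p.1 n) := by
  induction n with
  | zero => simp [freqSum]
  | succ n ih =>
    rw [Function.iterate_succ_apply', ih, baseMap]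
    ext1
    · funext i
      exact congrArg p.1 (by push_cast; ring)
    · simp [freqSum, Finset.sum_range_succ, add_assoc]

lemma cocycleIter_add (p : (ℤ → OmegaL d m L) × Td d) (n k : ℕ) :
    cocycleIter p.1 (n + k) p.2 =
      cocycleIter (baseMap^[n] p).1 k (baseMap^[n] p).2 * cocycleIter p.1 n p.2 := by
  induction k with
  | zero => simp [cocycleIter]
  | succ k ih =>
    have hf : p.2 + freqSum p.1 (n + k) = (baseMap^[n] p).2 + freqSum (baseMap^[n] p).1 k := by
      rw [baseMap_iterate]
      simp only [freqSum, Finset.sum_range_add, add_assoc]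
      push_cast
      simp only [add_comm]
    rw [← add_assoc, cocycleIter_succ, cocycleIter_succ, ih, hf, mul_assoc]
    congr 3
    rw [baseMap_iterate]
    simp [add_comm]

/-- The logarithmic growth of the cocycle. -/
def logGrowth (n : ℕ) (p : (ℤ → OmegaL d m L) × Td d) : ℝ :=
  Real.log (matOpNorm (cocycleIter p.1 n p.2))

lemma matOpNorm_cocycleIter_le (ω : ℤ → OmegaL d m L) (n : ℕ) (θ : Td d) :
    matOpNorm (cocycleIter ω n θ) ≤ L ^ n := by
  induction n with
  | zero =>
    simp only [cocycleIter, matOpNorm_eq, matCLM_one, pow_zero]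
    exact ContinuousLinearMap.norm_id_le
  | succ n ih =>
    rw [cocycleIter_succ, pow_succ']
    have h := (ω (n : ℤ)).2 (θ + freqSum ω n)
    exact (matOpNorm_mul_le _ _).trans
      (mul_le_mul h ih (norm_nonneg _) ((norm_nonneg _).trans h))

lemma IsBernoulli.map_restrict {ν : Measure (OmegaL d m L)} [IsProbabilityMeasure ν]
    {νZ : Measure (ℤ → OmegaL d m L)} (h : IsBernoulli ν νZ) (n : ℕ) :
    νZ.map (fun ω (i : Fin n) => ω ((i : ℕ) : ℤ)) = Measure.pi fun _ => ν := by
  symm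
  refine Measure.pi_eq fun s hs => ?_
  rw [Measure.map_apply (by fun_prop) (.univ_pi hs)]
  have := h.2 (Finset.univ.image fun i : Fin n => ((i : ℕ) : ℤ))
    (fun i => if hi : i.toNat < n then s ⟨i.toNat, hi⟩ else Set.univ) fun i => by
      split_ifs with hi
      · exact hs _
      · exact .univ
  rw [Finset.prod_image fun i _ j _ hij => by
    simpa [Fin.ext_iff] using hij] at this
  simp only [Int.toNat_natCast, Fin.is_lt, dite_true, Fin.eta] at this
  rw [← this]
  congr 1
  ext ω
  simp [Set.mem_pi]

variable [NeZero m]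

lemma one_le_matOpNorm_cocycleIter (ω : ℤ → OmegaL d m L) (n : ℕ) (θ : Td d) :
    1 ≤ matOpNorm (cocycleIter ω n θ) :=
  one_le_matOpNorm_of_det_eq_one (det_cocycleIter ω n θ)

lemma continuous_logGrowth (n : ℕ) : Continuous (logGrowth (d := d) (m := m) (L := L) n) :=
  (continuous_matOpNorm.comp (continuous_cocycleIter n)).log fun p =>
    (one_pos.trans_le (one_le_matOpNorm_cocycleIter p.1 n p.2)).ne'

lemma abs_logGrowth_le (n : ℕ) (p : (ℤ → OmegaL d m L) × Td d) :
    |logGrowth n p| ≤ Real.log (L ^ n) := by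
  have h := one_le_matOpNorm_cocycleIter p.1 n p.2
  rw [logGrowth, abs_of_nonneg (Real.log_nonneg h)]
  exact Real.log_le_log (one_pos.trans_le h) (matOpNorm_cocycleIter_le _ _ _)

lemma logGrowth_add_le (n k : ℕ) (p : (ℤ → OmegaL d m L) × Td d) :
    logGrowth (n + k) p ≤ logGrowth k (baseMap^[n] p) + logGrowth n p := by
  have h1 := one_le_matOpNorm_cocycleIter p.1 n p.2
  have h2 := one_le_matOpNorm_cocycleIter (baseMap^[n] p).1 k (baseMap^[n] p).2
  have h3 := one_le_matOpNorm_cocycleIter p.1 (n + k) p.2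
  rw [logGrowth, logGrowth, logGrowth, ← Real.log_mul (by positivity) (by positivity)]
  refine Real.log_le_log (by positivity) ?_
  rw [cocycleIter_add]
  exact matOpNorm_mul_le _ _

section Invariant

variable {P : Measure ((ℤ → OmegaL d m L) × Td d)} [IsProbabilityMeasure P]

lemma integrable_logGrowth (n : ℕ) : Integrable (logGrowth n) P :=
  integrable_of_continuous_of_bound (continuous_logGrowth n) (abs_logGrowth_le n)

lemma integral_logGrowth_mul_le (hP : MeasurePreserving baseMap P P) (n q : ℕ) :
    ∫ p, logGrowth (q * n) p ∂P ≤ q * ∫ p, logGrowth n p ∂P := by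
  induction q with
  | zero =>
    have h : ∀ p : (ℤ → OmegaL d m L) × Td d, logGrowth 0 p = 0 := fun p => by
      have := abs_logGrowth_le 0 p
      simpa using this
    simp [h]
  | succ q ih =>
    have hpres := hP.iterate (q * n)
    have hcomp : ∫ p, logGrowth n (baseMap^[q * n] p) ∂P = ∫ p, logGrowth n p ∂P := by
      conv_rhs => rw [← hpres.map_eq]
      exact (integral_map hpres.measurable.aemeasurable
        (continuous_logGrowth n).measurable.aestronglyMeasurable).symm
    have h_int : Integrable (fun p => logGrowth n (baseMap^[q * n] p)) P :=
      hpres.integrable_comp_of_integrable (integrable_logGrowth n)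
    have h := integral_mono (integrable_logGrowth (q * n + n))
      (h_int.add (integrable_logGrowth (q * n))) (logGrowth_add_le (q * n) n)
    have h' : ∫ p, logGrowth (q * n + n) p ∂P ≤
        ∫ p, (logGrowth n (baseMap^[q * n] p) + logGrowth (q * n) p) ∂P := h
    rw [integral_add h_int (integrable_logGrowth _), hcomp] at h'
    rw [Nat.succ_mul]
    push_cast
    linarith

/-- The Lyapunov exponent is bounded by the finite-time averages. -/
lemma le_integral_logGrowth (hP : MeasurePreserving baseMap P P) {ℓ : ℝ}
    (hℓ : Tendsto (fun n : ℕ => (1 / (n : ℝ)) * ∫ p, logGrowth n p ∂P) atTop (𝓝 ℓ))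
    {n : ℕ} (hn : 0 < n) : ℓ ≤ (1 / (n : ℝ)) * ∫ p, logGrowth n p ∂P := by
  have hsub : Tendsto (fun q : ℕ => q * n) atTop atTop :=
    tendsto_atTop_mono (fun q => Nat.le_mul_of_pos_right q hn) tendsto_id
  refine le_of_tendsto (hℓ.comp hsub) ?_
  filter_upwards [eventually_gt_atTop 0] with q hq
  have hq' : (0 : ℝ) < q := by exact_mod_cast hq
  have hn' : (0 : ℝ) < n := by exact_mod_cast hn
  have h := integral_logGrowth_mul_le hP n q
  simp only [Function.comp_apply]
  calc _ ≤ (1 / ((q * n : ℕ) : ℝ)) * (q * ∫ p, logGrowth n p ∂P) := by gcongr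
    _ = _ := by push_cast; field_simp

end Invariant

/-- Extend a finite word periodically in the positive direction. -/
def extendWord {n : ℕ} [NeZero n] (x : Fin n → OmegaL d m L) (i : ℤ) : OmegaL d m L :=
  x (Fin.ofNat n i.toNat)

/-- The fiberwise average of the logarithmic growth, as a function of a finite word. -/
def wordGrowth (n : ℕ) [NeZero n] (x : Fin n → OmegaL d m L) : ℝ :=
  ∫ θ : Td d, logGrowth n (extendWord x, θ)

lemma abs_wordGrowth_le (n : ℕ) [NeZero n] (x : Fin n → OmegaL d m L) :
    |wordGrowth n x| ≤ Real.log (L ^ n) := by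
  have := norm_integral_le_of_norm_le_const (μ := (volume : Measure (Td d)))
    (f := fun θ => logGrowth n (extendWord x, θ)) (.of_forall fun θ => abs_logGrowth_le n _)
  rwa [probReal_univ, mul_one] at this

lemma continuous_wordGrowth (n : ℕ) [NeZero n] :
    Continuous (wordGrowth (d := d) (m := m) (L := L) n) := by
  have hext : Continuous (extendWord (d := d) (m := m) (L := L) (n := n)) :=
    continuous_pi fun i => continuous_apply _
  refine continuous_of_dominated (bound := fun _ => Real.log (L ^ n)) (fun x => ?_)
    (fun x => .of_forall fun θ => abs_logGrowth_le n _) (integrable_const _)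
    (.of_forall fun θ => ?_)
  · exact ((continuous_logGrowth n).comp (by fun_prop)).measurable.aestronglyMeasurable
  · exact (continuous_logGrowth n).comp (hext.prodMk continuous_const)

lemma integral_logGrowth_eq {ν : Measure (OmegaL d m L)} [IsProbabilityMeasure ν]
    {νZ : Measure (ℤ → OmegaL d m L)} (h : IsBernoulli ν νZ) (n : ℕ) [NeZero n] :
    ∫ p, logGrowth n p ∂(νZ.prod (volume : Measure (Td d))) =
      ∫ x, wordGrowth n x ∂(Measure.pi fun _ => ν) := by
  have := h.1
  rw [integral_prod _ (integrable_logGrowth n), ← h.map_restrict n,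
    integral_map (φ := fun (ω : ℤ → OmegaL d m L) (i : Fin n) => ω ((i : ℕ) : ℤ))
      (measurable_pi_lambda _ fun i => measurable_pi_apply _).aemeasurable
      (continuous_wordGrowth n).measurable.aestronglyMeasurable]
  refine integral_congr_ae (.of_forall fun ω => integral_congr_ae (.of_forall fun θ => ?_))
  simp only [logGrowth]
  rw [cocycleIter_congr fun i hi => ?_]
  simp [extendWord, Fin.ofNat, Nat.mod_eq_of_lt hi]

end Cocycles

/-- (Upper semicontinuity of the maximal Lyapunov exponent.)
On the set of compactly supported Borel probability measures `ν` on `Ω = 𝒢_L`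
whose base dynamics is ergodic, the maximal Lyapunov exponent `ν ↦ L₁(ν)` is
upper semicontinuous w.r.t. the Wasserstein distance: for every ergodic `ν₀`
and every `ε > 0` there is `δ > 0` such that every ergodic `ν` with
`W₁(ν, ν₀) < δ` satisfies `L₁(ν) < L₁(ν₀) + ε`. -/
theorem lyapunov_upper_semicontinuous {d m : ℕ} {L : ℝ}
    (ν₀ : Measure (OmegaL d m L)) [IsProbabilityMeasure ν₀]
    (hν₀ : ∃ K : Set (OmegaL d m L), IsCompact K ∧ ν₀ Kᶜ = 0)
    (ν₀Z : Measure (ℤ → OmegaL d m L)) (hν₀Z : IsBernoulli ν₀ ν₀Z)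
    (herg₀ : Ergodic baseMap (ν₀Z.prod volume))
    (ℓ₀ : ℝ)
    (hℓ₀ : Tendsto (fun n : ℕ =>
        (1 / (n : ℝ)) * ∫ p, Real.log (matOpNorm (cocycleIter p.1 n p.2))
          ∂(ν₀Z.prod (volume : Measure (Td d))))
      atTop (𝓝 ℓ₀)) :
    ∀ ε > (0:ℝ), ∃ δ > (0:ℝ),
      ∀ (ν : Measure (OmegaL d m L)), IsProbabilityMeasure ν →
        (∃ K : Set (OmegaL d m L), IsCompact K ∧ ν Kᶜ = 0) →
        W1rho (fun x y => qpcDist x.val y.val) ν ν₀ < δ →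
        ∀ (νZ : Measure (ℤ → OmegaL d m L)), IsBernoulli ν νZ →
          Ergodic baseMap (νZ.prod volume) →
          ∀ ℓ : ℝ,
            Tendsto (fun n : ℕ =>
                (1 / (n : ℝ)) * ∫ p, Real.log (matOpNorm (cocycleIter p.1 n p.2))
                  ∂(νZ.prod (volume : Measure (Td d))))
              atTop (𝓝 ℓ) →
            ℓ < ℓ₀ + ε := by
  intro ε hε
  rcases Nat.eq_zero_or_pos m with rfl | hm
  · have hzero : ∀ A : Matrix (Fin 0) (Fin 0) ℝ, Real.log (matOpNorm A) = 0 := fun A => by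
      rw [matOpNorm_eq, Subsingleton.elim A 0, map_zero, norm_zero, Real.log_zero]
    simp only [hzero, integral_zero, mul_zero] at hℓ₀ ⊢
    refine ⟨1, one_pos, fun _ _ _ _ _ _ _ ℓ hℓ => ?_⟩
    rw [tendsto_nhds_unique hℓ tendsto_const_nhds, tendsto_nhds_unique hℓ₀ tendsto_const_nhds]
    linarith
  have : NeZero m := ⟨hm.ne'⟩
  have : IsProbabilityMeasure ν₀Z := hν₀Z.1
  obtain ⟨n, hlt, hn⟩ := ((hℓ₀.eventually_lt_const (show ℓ₀ < ℓ₀ + ε / 2 by linarith)).and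
    (eventually_gt_atTop 0)).exists
  have : NeZero n := ⟨hn.ne'⟩
  have hn' : (0 : ℝ) < n := by exact_mod_cast hn
  obtain ⟨δ, hδ, hW⟩ := exists_integral_pi_lt ν₀ (continuous_wordGrowth (d := d) (m := m) (L := L) n)
    (abs_wordGrowth_le n) (η := n * (ε / 2)) (by positivity)
  refine ⟨δ, hδ, fun ν _ _ hνδ νZ hνZ herg ℓ hℓ => ?_⟩
  have : IsProbabilityMeasure νZ := hνZ.1
  have h1 := le_integral_logGrowth herg.toMeasurePreserving hℓ hn
  have h2 := hW ν inferInstance fun g hg => (integral_sub_le_W1rho ν ν₀ hg).trans hνδ.le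
  rw [← integral_logGrowth_eq hνZ n, ← integral_logGrowth_eq hν₀Z n] at h2
  change (1 / (n : ℝ)) * ∫ p, logGrowth n p ∂_ < _ at hlt
  have h3 := mul_lt_mul_of_pos_left h2 (one_div_pos.2 hn')
  have h4 : 1 / (n : ℝ) * (n * (ε / 2)) = ε / 2 := by field_simp
  rw [mul_add, h4] at h3
  linarith
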